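/- For every integer n ≥ 6, T(2n,6) = (21/512)·t(2n) − (7/192)·t(2)·t(2n-2) + (1/256)·t(4)·t(2n-4), where t(2m) = Σ_{k≥1} 1/(2k-1)^{2m}. -/

import Mathlib

open scoped BigOperators

/-- Depth-one multiple t-value: `t1 m = t(2m) = ∑_{k ≥ 1} 1/(2k-1)^{2m}`. -/
noncomputable def t1 (m : ℕ) : ℝ := ∑' k : ℕ, 1 / (2 * (k : ℝ) + 1) ^ (2 * m)

/-- Multiple t-value `t(s₀, …, s_{d-1})`, summed over `n₀ > n₁ > ⋯ > n_{d-1} ≥ 1`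
(encoded via `f i = n_i - 1`, so the odd number `2 n_i - 1` is `2 (f i) + 1`). -/
noncomputable def mtv (d : ℕ) (s : Fin d → ℕ) : ℝ :=
  ∑' f : {f : Fin d → ℕ // StrictAnti f}, ∏ i, 1 / (2 * (f.1 i : ℝ) + 1) ^ (s i)

/-- `Tsum n d = T(2n, d)`: the sum of all multiple t-values of weight `2n` and
depth `d` with all arguments even. -/
noncomputable def Tsum (n d : ℕ) : ℝ :=
  ∑ j ∈ (Finset.Nat.antidiagonalTuple d n).filter (fun j => ∀ i, 1 ≤ j i),
    mtv d (fun i => 2 * j i)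

section

open Filter Topology Finset

/-- Expansion of `∏ (1 + z u_k)` in elementary symmetric functions of `u`. -/
theorem prod_one_add_mul_eq_sum_powersetCard {ι R : Type*} [CommRing R] (s : Finset ι)
    (u : ι → R) (z : R) :
    ∏ k ∈ s, (1 + z * u k) =
      ∑ m ∈ range (#s + 1), z ^ m * ∑ t ∈ s.powersetCard m, ∏ k ∈ t, u k := by
  classical
  rw [prod_one_add, sum_powerset]
  refine sum_congr rfl fun m _ => ?_
  rw [mul_sum]
  refine sum_congr rfl fun t ht => ?_
  rw [prod_mul_distrib, prod_const, (mem_powersetCard.1 ht).2]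

/-- If `g = u / (1 - u)`, the elementary symmetric functions of `g` times `∏ (1 - u_k)` are
binomial combinations of those of `u`. -/
theorem prod_one_sub_mul_sum_powersetCard {ι R : Type*} [CommRing R] (s : Finset ι)
    (u g : ι → R) (h : ∀ k, g k * (1 - u k) = u k) (d : ℕ) :
    (∏ k ∈ s, (1 - u k)) * ∑ t ∈ s.powersetCard d, ∏ k ∈ t, g k =
      ∑ m ∈ range (#s + 1),
        (-1) ^ (m - d) * (m.choose d : R) * ∑ t ∈ s.powersetCard m, ∏ k ∈ t, u k := by
  have key : Polynomial.C (∏ k ∈ s, (1 - u k)) *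
        ∏ k ∈ s, (1 + Polynomial.X * Polynomial.C (g k)) =
      ∏ k ∈ s, (1 + (Polynomial.X + Polynomial.C (-1)) * Polynomial.C (u k)) := by
    rw [map_prod, ← prod_mul_distrib]
    refine prod_congr rfl fun k _ => ?_
    have hk := congrArg Polynomial.C (h k)
    simp only [map_mul, map_sub, map_one, map_neg] at hk ⊢
    linear_combination Polynomial.X * hk
  rw [prod_one_add_mul_eq_sum_powersetCard, prod_one_add_mul_eq_sum_powersetCard] at key
  have key := congrArg (fun p => Polynomial.coeff p d) key
  simp only [Polynomial.coeff_C_mul, Polynomial.finsetSum_coeff, ← map_prod, ← map_sum,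
    Polynomial.coeff_mul_C, Polynomial.coeff_X_pow, Polynomial.coeff_X_add_C_pow] at key
  rw [← key]
  congr 1
  simp only [ite_mul, one_mul, zero_mul, sum_ite_eq, mem_range]
  split_ifs with hd
  · rfl
  · rw [powersetCard_eq_empty.2 (by omega), sum_empty]

/-- The inverse square `1 / (2k+1)²` of the `k`-th odd number. -/
noncomputable def oddInvSq (k : ℕ) : ℝ := 1 / (2 * (k : ℝ) + 1) ^ 2

theorem oddInvSq_nonneg (k : ℕ) : 0 ≤ oddInvSq k := by unfold oddInvSq; positivity

theorem oddInvSq_pow (k m : ℕ) : oddInvSq k ^ m = 1 / (2 * (k : ℝ) + 1) ^ (2 * m) := by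
  rw [oddInvSq, div_pow, one_pow, pow_mul]

theorem summable_odd_inv_pow {s : ℕ} (hs : 2 ≤ s) :
    Summable fun k : ℕ => 1 / (2 * (k : ℝ) + 1) ^ s := by
  have h : Summable fun k : ℕ => 1 / ((k + 1 : ℕ) : ℝ) ^ s :=
    (summable_nat_add_iff 1).2 (Real.summable_one_div_nat_pow.2 (by omega))
  refine h.of_nonneg_of_le (fun k => by positivity) fun k => ?_
  push_cast
  gcongr
  linarith [(Nat.cast_nonneg k : (0 : ℝ) ≤ k)]

theorem summable_oddInvSq : Summable oddInvSq := summable_odd_inv_pow le_rfl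

/-- The `m`-th elementary symmetric function of the first `N` values of `oddInvSq`. -/
noncomputable def oddEsymm (N m : ℕ) : ℝ :=
  ∑ t ∈ (range N).powersetCard m, ∏ k ∈ t, oddInvSq k

theorem oddEsymm_nonneg (N m : ℕ) : 0 ≤ oddEsymm N m :=
  sum_nonneg fun _ _ => prod_nonneg fun k _ => oddInvSq_nonneg k

theorem oddEsymm_eq_zero {N m : ℕ} (h : N < m) : oddEsymm N m = 0 := by
  rw [oddEsymm, powersetCard_eq_empty.2 (by simpa using h), sum_empty]

theorem oddEsymm_monotone (m : ℕ) : Monotone fun N => oddEsymm N m := fun _ _ h =>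
  sum_le_sum_of_subset_of_nonneg (powersetCard_mono (range_mono h))
    fun _ _ _ => prod_nonneg fun k _ => oddInvSq_nonneg k

theorem prod_one_add_mul_oddInvSq (N : ℕ) (y : ℝ) :
    ∏ k ∈ range N, (1 + y * oddInvSq k) = ∑ m ∈ range (N + 1), y ^ m * oddEsymm N m := by
  simpa [oddEsymm] using prod_one_add_mul_eq_sum_powersetCard (range N) oddInvSq y

theorem oddEsymm_le (N m : ℕ) :
    oddEsymm N m ≤ Real.exp (2 * ∑' k, oddInvSq k) * (1 / 2) ^ m := by
  have h1 : 2 ^ m * oddEsymm N m ≤ Real.exp (2 * ∑' k, oddInvSq k) := by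
    rcases lt_or_ge N m with h | h
    · rw [oddEsymm_eq_zero h, mul_zero]; positivity
    calc 2 ^ m * oddEsymm N m ≤ ∑ i ∈ range (N + 1), 2 ^ i * oddEsymm N i :=
          single_le_sum (f := fun i => 2 ^ i * oddEsymm N i)
            (fun i _ => mul_nonneg (by positivity) (oddEsymm_nonneg N i)) (by simp; omega)
      _ = ∏ k ∈ range N, (1 + 2 * oddInvSq k) := (prod_one_add_mul_oddInvSq N 2).symm
      _ ≤ Real.exp (∑ k ∈ range N, 2 * oddInvSq k) :=
          Real.prod_one_add_le_exp_sum _ fun k => mul_nonneg zero_le_two (oddInvSq_nonneg k)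
      _ ≤ _ := by
          rw [← mul_sum]
          gcongr
          exact summable_oddInvSq.sum_le_tsum _ fun k _ => oddInvSq_nonneg k
  rw [one_div, inv_pow, ← div_eq_mul_inv, le_div_iff₀ (by positivity)]
  linarith

/-- The product formula for the cosine. -/
theorem tendsto_prod_one_sub_sq_mul_oddInvSq {s : ℝ} (h0 : 0 < s) (h1 : s < 2) :
    Tendsto (fun N => ∏ k ∈ range N, (1 - s ^ 2 * oddInvSq k)) atTop
      (𝓝 (Real.cos (Real.pi * (s / 2)))) := by
  have hs : 0 < Real.sin (Real.pi * (s / 2)) :=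
    Real.sin_pos_of_pos_of_lt_pi (by positivity) (by nlinarith [Real.pi_pos])
  have hA := (Real.tendsto_euler_sin_prod s).comp (tendsto_id.const_mul_atTop' two_pos)
  have hB := Real.tendsto_euler_sin_prod (s / 2)
  have hdiv := (hA.div hB hs.ne').div_const 2
  have hlim : Real.sin (Real.pi * s) / Real.sin (Real.pi * (s / 2)) / 2 =
      Real.cos (Real.pi * (s / 2)) := by
    rw [show Real.pi * s = 2 * (Real.pi * (s / 2)) by ring, Real.sin_two_mul, div_div,
      div_eq_iff (by positivity)]
    ring
  rw [hlim] at hdiv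
  refine hdiv.congr' ?_
  filter_upwards [hB.eventually_ne hs.ne'] with N hN
  have hsplit : ∀ N, ∏ j ∈ range (2 * N), (1 - s ^ 2 / ((j : ℝ) + 1) ^ 2) =
      (∏ k ∈ range N, (1 - s ^ 2 * oddInvSq k)) *
        ∏ j ∈ range N, (1 - (s / 2) ^ 2 / ((j : ℝ) + 1) ^ 2) := by
    intro N
    induction N with
    | zero => simp
    | succ N ih =>
      rw [show 2 * (N + 1) = 2 * N + 1 + 1 by ring, prod_range_succ, prod_range_succ, ih,
        prod_range_succ, prod_range_succ, oddInvSq]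
      have h3 : (((2 * N + 1 : ℕ) : ℝ) + 1) = 2 * ((N : ℝ) + 1) := by push_cast; ring
      have h4 : (s / 2) ^ 2 / ((N : ℝ) + 1) ^ 2 = s ^ 2 / (2 * ((N : ℝ) + 1)) ^ 2 := by
        rw [div_pow, mul_pow, div_div]
      rw [h3, h4]
      push_cast
      ring
  simp only [Pi.div_apply, Function.comp, id] at hN ⊢
  rw [hsplit, div_div, div_eq_iff (mul_ne_zero hN two_ne_zero)]
  ring

/-- A power series with bounded coefficients that vanishes on `(0, 1)` is zero. -/
theorem eq_zero_of_hasSum_zero {a : ℕ → ℝ} {C : ℝ} (ha : ∀ m, |a m| ≤ C)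
    (h : ∀ y : ℝ, 0 < y → y < 1 → HasSum (fun m => a m * y ^ m) 0) (m : ℕ) : a m = 0 := by
  set p := FormalMultilinearSeries.ofScalars ℝ a with hp
  have hr : 1 ≤ p.radius := by
    refine p.le_radius_of_bound C (r := 1) fun n => ?_
    rw [hp, FormalMultilinearSeries.ofScalars_norm]
    simpa using ha n
  have hps : HasFPowerSeriesAt p.sum p 0 :=
    (p.hasFPowerSeriesOnBall (zero_lt_one.trans_le hr)).hasFPowerSeriesAt
  have hsum : ∀ y : ℝ, 0 < y → y < 1 → p.sum y = 0 := fun y h0 h1 => by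
    rw [← (h y h0 h1).tsum_eq]
    exact tsum_congr fun n => by
      simp [hp, mul_comm]
  have hfreq : ∃ᶠ y in 𝓝[≠] (0 : ℝ), p.sum y = 0 := by
    have hev : ∀ᶠ y in 𝓝[>] (0 : ℝ), p.sum y = 0 := by
      filter_upwards [Ioo_mem_nhdsGT (zero_lt_one' ℝ)] with y hy using hsum y hy.1 hy.2
    exact hev.frequently.filter_mono (nhdsWithin_mono 0 fun y hy => ne_of_gt hy)
  have h0 := hps.eq_zero_of_eventually
    (hps.analyticAt.frequently_zero_iff_eventually_zero.1 hfreq)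
  rw [hp, FormalMultilinearSeries.ofScalars_series_eq_zero] at h0
  exact congrFun h0 m

/-- The elementary symmetric functions of all `1 / (2k+1)²` are the coefficients of the cosine. -/
theorem tendsto_oddEsymm (m : ℕ) :
    Tendsto (fun N => oddEsymm N m) atTop
      (𝓝 ((Real.pi ^ 2 / 4) ^ m / (Nat.factorial (2 * m) : ℝ))) := by
  set B := Real.exp (2 * ∑' k, oddInvSq k) with hB
  set c : ℕ → ℝ := fun m => (Real.pi ^ 2 / 4) ^ m / (Nat.factorial (2 * m) : ℝ) with hc
  have hbdd : ∀ m, BddAbove (Set.range fun N => oddEsymm N m) := fun m =>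
    ⟨B * (1 / 2) ^ m, by rintro _ ⟨N, rfl⟩; exact oddEsymm_le N m⟩
  set e : ℕ → ℝ := fun m => ⨆ N, oddEsymm N m with he
  have hlim : ∀ m, Tendsto (fun N => oddEsymm N m) atTop (𝓝 (e m)) := fun m =>
    tendsto_atTop_ciSup (oddEsymm_monotone m) (hbdd m)
  have he0 : ∀ m, 0 ≤ e m := fun m => ge_of_tendsto' (hlim m) fun N => oddEsymm_nonneg N m
  have heB : ∀ m, e m ≤ B * (1 / 2) ^ m := fun m =>
    le_of_tendsto' (hlim m) fun N => oddEsymm_le N m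
  have hgeom : Summable fun m : ℕ => B * (1 / 2 : ℝ) ^ m := summable_geometric_two.mul_left B
  have hser : ∀ y : ℝ, |y| ≤ 1 → Summable fun m => (-y) ^ m * e m := fun y hy =>
    hgeom.of_norm_bounded fun m => by
      rw [norm_mul, norm_pow, norm_neg, Real.norm_eq_abs, Real.norm_of_nonneg (he0 m)]
      exact (mul_le_of_le_one_left (he0 m) (pow_le_one₀ (abs_nonneg y) hy)).trans (heB m)
  have hcos : ∀ y : ℝ, 0 < y → y < 1 → HasSum (fun m => (-y) ^ m * e m)
      (Real.cos (Real.pi * (√y / 2))) := by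
    intro y hy0 hy1
    have hT : Tendsto (fun N => ∑' m, (-y) ^ m * oddEsymm N m) atTop
        (𝓝 (∑' m, (-y) ^ m * e m)) := by
      refine tendsto_tsum_of_dominated_convergence hgeom (fun m => (hlim m).const_mul _)
        (Eventually.of_forall fun N m => ?_)
      rw [norm_mul, norm_pow, norm_neg, Real.norm_eq_abs, abs_of_pos hy0,
        Real.norm_of_nonneg (oddEsymm_nonneg N m)]
      exact (mul_le_of_le_one_left (oddEsymm_nonneg N m) (pow_le_one₀ hy0.le hy1.le)).trans
        (oddEsymm_le N m)
    have hP := tendsto_prod_one_sub_sq_mul_oddInvSq (Real.sqrt_pos.2 hy0)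
      ((Real.sqrt_lt' two_pos).2 (by linarith))
    rw [Real.sq_sqrt hy0.le] at hP
    have heq : ∀ N, ∏ k ∈ range N, (1 - y * oddInvSq k) = ∑' m, (-y) ^ m * oddEsymm N m := by
      intro N
      rw [tsum_eq_sum (s := range (N + 1)), ← prod_one_add_mul_oddInvSq]
      · exact prod_congr rfl fun k _ => by ring
      · intro m hm
        rw [oddEsymm_eq_zero (by simpa using hm), mul_zero]
    simp only [heq] at hP
    rw [← tendsto_nhds_unique hT hP]
    exact (hser y (by rw [abs_of_pos hy0]; exact hy1.le)).hasSum
  have hcosc : ∀ y : ℝ, 0 < y → HasSum (fun m => (-y) ^ m * c m)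
      (Real.cos (Real.pi * (√y / 2))) := by
    intro y hy
    convert Real.hasSum_cos (Real.pi * (√y / 2)) using 2 with m
    have h : (Real.pi * (√y / 2)) ^ 2 = Real.pi ^ 2 / 4 * y := by
      rw [mul_pow, div_pow, Real.sq_sqrt hy.le]; ring
    rw [pow_mul, h, neg_pow, mul_pow]
    simp only [hc]
    ring
  have hc0 : ∀ m, 0 ≤ c m := fun m => by positivity
  have hcB : ∀ m, c m ≤ Real.exp (Real.pi ^ 2 / 4) := fun m => by
    have h1 : c m ≤ (Real.pi ^ 2 / 4) ^ m / (Nat.factorial m : ℝ) := by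
      simp only [hc]
      gcongr
      omega
    exact h1.trans (Real.pow_div_factorial_le_exp _ (by positivity) m)
  have hzero : ∀ m, (-1) ^ m * (e m - c m) = 0 := by
    refine eq_zero_of_hasSum_zero (C := B + Real.exp (Real.pi ^ 2 / 4)) (fun m => ?_)
      fun y hy0 hy1 => ?_
    · rw [abs_mul, abs_pow, abs_neg, abs_one, one_pow, one_mul]
      have h1 : e m ≤ B := (heB m).trans
        (mul_le_of_le_one_right (Real.exp_pos _).le (pow_le_one₀ (by norm_num) (by norm_num)))
      have h2 : 0 ≤ B := (Real.exp_pos _).le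
      have h3 := (Real.exp_pos (Real.pi ^ 2 / 4)).le
      rw [abs_le]
      constructor <;> linarith [he0 m, hc0 m, hcB m]
    · have h := (hcos y hy0 hy1).sub (hcosc y hy0)
      rw [sub_self] at h
      convert! h using 2 with m
      rw [neg_pow]
      ring
  have hec : e m = c m := by
    have h := hzero m
    rwa [mul_eq_zero, or_iff_right (by simp), sub_eq_zero] at h
  simpa only [hec, hc] using hlim m

/-- The geometric series `x Y / (1 - x Y)`. -/
noncomputable def geomSeries (x : ℝ) : PowerSeries ℝ :=
  PowerSeries.mk fun j => if 1 ≤ j then x ^ j else 0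

theorem geomSeries_mul_one_sub (x : ℝ) :
    geomSeries x * (1 - PowerSeries.X * PowerSeries.C x) = PowerSeries.X * PowerSeries.C x := by
  rw [mul_sub, mul_one, ← mul_assoc, mul_comm _ (PowerSeries.X : PowerSeries ℝ)]
  ext n
  rcases n with _ | _ | n
  · simp [geomSeries, mul_assoc]
  · simp [geomSeries, mul_assoc, PowerSeries.coeff_succ_X_mul]
  · simp [geomSeries, mul_assoc, PowerSeries.coeff_succ_X_mul, PowerSeries.coeff_X, pow_succ]

/-- The generating series of the depth `d` sums truncated to the first `N` odd numbers. -/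
noncomputable def truncSeries (N d : ℕ) : PowerSeries ℝ :=
  ∑ t ∈ (range N).powersetCard d, ∏ k ∈ t, geomSeries (oddInvSq k)

theorem prod_X_mul_C_oddInvSq (t : Finset ℕ) :
    ∏ k ∈ t, (PowerSeries.X * PowerSeries.C (oddInvSq k)) =
      PowerSeries.X ^ #t * PowerSeries.C (∏ k ∈ t, oddInvSq k) := by
  rw [prod_mul_distrib, prod_const, map_prod]

theorem sum_powersetCard_prod_X_mul_C (N m : ℕ) :
    ∑ t ∈ (range N).powersetCard m, ∏ k ∈ t, (PowerSeries.X * PowerSeries.C (oddInvSq k)) =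
      PowerSeries.X ^ m * PowerSeries.C (oddEsymm N m) := by
  rw [oddEsymm, map_sum, mul_sum]
  refine sum_congr rfl fun t ht => ?_
  rw [prod_X_mul_C_oddInvSq, (mem_powersetCard.1 ht).2]

theorem coeff_sum_mul_X_pow_oddEsymm (N n : ℕ) (a : ℕ → ℝ) :
    PowerSeries.coeff n (∑ m ∈ range (N + 1),
      PowerSeries.C (a m) * (PowerSeries.X ^ m * PowerSeries.C (oddEsymm N m))) =
      a n * oddEsymm N n := by
  simp only [map_sum, PowerSeries.coeff_C_mul, PowerSeries.coeff_mul_C, PowerSeries.coeff_X_pow]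
  simp only [ite_mul, one_mul, zero_mul, mul_ite, mul_zero, sum_ite_eq, mem_range]
  split_ifs with h
  · rfl
  · rw [oddEsymm_eq_zero (by omega), mul_zero]

theorem coeff_prod_one_sub (N n : ℕ) :
    PowerSeries.coeff n (∏ k ∈ range N, (1 - PowerSeries.X * PowerSeries.C (oddInvSq k))) =
      (-1) ^ n * oddEsymm N n := by
  have h := prod_one_add_mul_eq_sum_powersetCard (range N)
    (fun k => PowerSeries.X * PowerSeries.C (oddInvSq k)) (-1)
  simp only [sum_powersetCard_prod_X_mul_C, card_range, neg_one_mul, ← sub_eq_add_neg] at h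
  rw [h, ← coeff_sum_mul_X_pow_oddEsymm]
  simp

theorem sum_antidiagonal_oddEsymm_mul_coeff_truncSeries (N d n : ℕ) :
    ∑ p ∈ antidiagonal n,
      (-1) ^ p.1 * oddEsymm N p.1 * PowerSeries.coeff p.2 (truncSeries N d) =
      (-1) ^ (n - d) * (n.choose d : ℝ) * oddEsymm N n := by
  have h := prod_one_sub_mul_sum_powersetCard (range N)
    (fun k => PowerSeries.X * PowerSeries.C (oddInvSq k))
    (fun k => geomSeries (oddInvSq k)) (fun k => geomSeries_mul_one_sub _) d
  have h := congrArg (PowerSeries.coeff n) h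
  rw [PowerSeries.coeff_mul] at h
  simp only [coeff_prod_one_sub] at h
  rw [truncSeries, h, ← coeff_sum_mul_X_pow_oddEsymm N n fun m => (-1) ^ (m - d) * (m.choose d : ℝ)]
  simp only [sum_powersetCard_prod_X_mul_C, card_range]
  simp

/-- The strictly decreasing `d`-tuples with entries below `N`. -/
noncomputable def strictAntiBelow (d N : ℕ) : Finset {f : Fin d → ℕ // StrictAnti f} :=
  open Classical in (Fintype.piFinset fun _ : Fin d => range N).subtype StrictAnti

theorem mem_strictAntiBelow {d N : ℕ} {f : {f : Fin d → ℕ // StrictAnti f}} :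
    f ∈ strictAntiBelow d N ↔ ∀ i, f.1 i < N := by
  simp [strictAntiBelow, Fintype.mem_piFinset]

theorem tendsto_strictAntiBelow (d : ℕ) : Tendsto (strictAntiBelow d) atTop atTop := by
  refine tendsto_atTop_finset_of_monotone (fun M N h f hf => ?_) fun f => ?_
  · exact mem_strictAntiBelow.2 fun i => (mem_strictAntiBelow.1 hf i).trans_le h
  · refine ⟨∑ i, f.1 i + 1, mem_strictAntiBelow.2 fun i => Nat.lt_succ_of_le ?_⟩
    exact single_le_sum (f := f.1) (fun _ _ => Nat.zero_le _) (mem_univ i)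

theorem summable_pi_prod {d : ℕ} {g : Fin d → ℕ → ℝ} (h0 : ∀ i k, 0 ≤ g i k)
    (hg : ∀ i, Summable (g i)) : Summable fun f : Fin d → ℕ => ∏ i, g i (f i) := by
  classical
  refine summable_of_sum_le (c := ∏ i, ∑' k, g i k)
    (fun f => prod_nonneg fun i _ => h0 i (f i)) fun u => ?_
  calc ∑ f ∈ u, ∏ i, g i (f i)
      ≤ ∑ f ∈ Fintype.piFinset fun i => u.image fun f => f i, ∏ i, g i (f i) :=
        sum_le_sum_of_subset_of_nonneg
          (fun f hf => Fintype.mem_piFinset.2 fun i => mem_image_of_mem _ hf)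
          fun f _ _ => prod_nonneg fun i _ => h0 i (f i)
    _ = ∏ i, ∑ k ∈ u.image fun f => f i, g i k := (prod_univ_sum _ _).symm
    _ ≤ _ := prod_le_prod (fun i _ => sum_nonneg fun k _ => h0 i k)
        fun i _ => (hg i).sum_le_tsum _ fun k _ => h0 i k

theorem tendsto_sum_strictAntiBelow_mtv {d : ℕ} {s : Fin d → ℕ} (hs : ∀ i, 2 ≤ s i) :
    Tendsto (fun N => ∑ f ∈ strictAntiBelow d N, ∏ i, 1 / (2 * (f.1 i : ℝ) + 1) ^ s i) atTop
      (𝓝 (mtv d s)) := by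
  have h : Summable fun f : Fin d → ℕ => ∏ i, 1 / (2 * (f i : ℝ) + 1) ^ s i :=
    summable_pi_prod (g := fun i k => 1 / (2 * (k : ℝ) + 1) ^ s i) (fun i k => by positivity)
      fun i => summable_odd_inv_pow (hs i)
  exact (h.subtype {f | StrictAnti f}).hasSum.comp (tendsto_strictAntiBelow d)

theorem sum_antidiagonalTuple_eq_coeff_prod (d n : ℕ) (x : Fin d → ℝ) :
    ∑ j ∈ (Finset.Nat.antidiagonalTuple d n).filter (fun j => ∀ i, 1 ≤ j i), ∏ i, x i ^ j i =
      PowerSeries.coeff n (∏ i, geomSeries (x i)) := by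
  classical
  rw [PowerSeries.coeff_prod, sum_filter]
  refine sum_nbij' (fun j => Finsupp.equivFunOnFinite.symm j) (fun l => l) ?_ ?_ ?_ ?_ ?_
  · intro j hj
    simpa [mem_finsuppAntidiag, Finset.Nat.mem_antidiagonalTuple] using hj
  · intro l hl
    simpa [mem_finsuppAntidiag, Finset.Nat.mem_antidiagonalTuple] using hl
  · intro j _; simp
  · intro l _; ext; simp
  · intro j _
    simp only [geomSeries, PowerSeries.coeff_mk, Finsupp.equivFunOnFinite_symm_apply_apply]
    split_ifs with h
    · exact prod_congr rfl fun i _ => (if_pos (h i)).symm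
    · obtain ⟨i, hi⟩ := not_forall.1 h
      exact (prod_eq_zero (mem_univ i) (if_neg hi)).symm

theorem sum_strictAntiBelow_prod {R : Type*} [CommSemiring R] (d N : ℕ) (g : ℕ → R) :
    ∑ f ∈ strictAntiBelow d N, ∏ i, g (f.1 i) =
      ∑ t ∈ (range N).powersetCard d, ∏ k ∈ t, g k := by
  classical
  refine sum_bij (fun f _ => univ.image f.1) ?_ ?_ ?_ ?_
  · intro f hf
    rw [mem_powersetCard, card_image_of_injective _ f.2.injective, card_univ, Fintype.card_fin]
    refine ⟨fun k hk => ?_, rfl⟩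
    obtain ⟨i, -, rfl⟩ := mem_image.1 hk
    exact mem_range.2 (mem_strictAntiBelow.1 hf i)
  · intro f _ f' _ h
    have h' := congrArg (fun s : Finset ℕ => (s : Set ℕ)) h
    simp only [coe_image, coe_univ, Set.image_univ] at h'
    exact Subtype.ext ((StrictAnti.range_inj f.2 f'.2).1 h')
  · intro t ht
    obtain ⟨hts, htc⟩ := mem_powersetCard.1 ht
    refine ⟨⟨fun i => t.orderEmbOfFin htc i.rev, fun i j hij =>
      (t.orderEmbOfFin htc).strictMono (Fin.rev_lt_rev.2 hij)⟩, ?_, ?_⟩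
    · exact mem_strictAntiBelow.2 fun i => mem_range.1 (hts (orderEmbOfFin_mem t htc _))
    · refine eq_of_subset_of_card_le (fun k hk => ?_) ?_
      · obtain ⟨i, -, rfl⟩ := mem_image.1 hk
        exact orderEmbOfFin_mem t htc _
      · rw [card_image_of_injective, card_univ, Fintype.card_fin, htc]
        exact (t.orderEmbOfFin htc).injective.comp Fin.rev_injective
  · intro f _
    rw [prod_image fun i _ j _ h => f.2.injective h]

theorem tendsto_coeff_truncSeries (n d : ℕ) :
    Tendsto (fun N => PowerSeries.coeff n (truncSeries N d)) atTop (𝓝 (Tsum n d)) := by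
  have h : Tendsto (fun N => ∑ j ∈ (Finset.Nat.antidiagonalTuple d n).filter (fun j => ∀ i, 1 ≤ j i),
      ∑ f ∈ strictAntiBelow d N, ∏ i, 1 / (2 * (f.1 i : ℝ) + 1) ^ (2 * j i)) atTop
      (𝓝 (Tsum n d)) :=
    tendsto_finsetSum _ fun j hj => tendsto_sum_strictAntiBelow_mtv fun i => by
      have := (mem_filter.1 hj).2 i
      omega
  refine h.congr fun N => ?_
  rw [sum_comm, truncSeries, ← sum_strictAntiBelow_prod, map_sum]
  refine sum_congr rfl fun f _ => ?_
  rw [← sum_antidiagonalTuple_eq_coeff_prod]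
  simp only [oddInvSq_pow]

theorem Tsum_one {n : ℕ} (hn : 1 ≤ n) : Tsum n 1 = t1 n := by
  refine tendsto_nhds_unique (tendsto_coeff_truncSeries n 1) ?_
  have h := (summable_odd_inv_pow (s := 2 * n) (by omega)).hasSum.tendsto_sum_nat
  refine h.congr fun N => ?_
  simp [truncSeries, powersetCard_one, geomSeries, hn, oddInvSq_pow]

theorem Tsum_zero_one : Tsum 0 1 = 0 := by
  rw [Tsum, sum_eq_zero]
  intro j hj
  obtain ⟨hj0, hj1⟩ := mem_filter.1 hj
  rw [Finset.Nat.mem_antidiagonalTuple, Fin.sum_univ_one] at hj0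
  exact absurd (hj1 0) (by omega)

/-- The coefficients of `cos (π √y / 2)`, up to sign. -/
noncomputable def cosCoeff (n : ℕ) : ℝ :=
  (-1) ^ n * ((Real.pi ^ 2 / 4) ^ n / (Nat.factorial (2 * n) : ℝ))

theorem cosCoeff_succ (n : ℕ) :
    cosCoeff (n + 1) * ((2 * n + 1) * (2 * n + 2)) = -(Real.pi ^ 2 / 4) * cosCoeff n := by
  have h : ((2 * (n + 1)).factorial : ℝ) = (2 * n + 1) * (2 * n + 2) * (2 * n).factorial := by
    rw [show 2 * (n + 1) = 2 * n + 1 + 1 by ring, Nat.factorial_succ, Nat.factorial_succ]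
    push_cast
    ring
  have h0 : ((2 * n).factorial : ℝ) ≠ 0 := by positivity
  have h1 : (2 * (n : ℝ) + 1) * (2 * n + 2) ≠ 0 := by positivity
  rw [cosCoeff, cosCoeff, h]
  field_simp
  ring

theorem sum_antidiagonal_cosCoeff_mul_Tsum (n d : ℕ) :
    ∑ p ∈ antidiagonal n, cosCoeff p.1 * Tsum p.2 d = (-1) ^ d * n.choose d * cosCoeff n := by
  have hL : Tendsto (fun N => ∑ p ∈ antidiagonal n,
      (-1) ^ p.1 * oddEsymm N p.1 * PowerSeries.coeff p.2 (truncSeries N d)) atTop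
      (𝓝 (∑ p ∈ antidiagonal n, cosCoeff p.1 * Tsum p.2 d)) :=
    tendsto_finsetSum _ fun p _ =>
      ((tendsto_oddEsymm p.1).const_mul _).mul (tendsto_coeff_truncSeries p.2 d)
  simp only [sum_antidiagonal_oddEsymm_mul_coeff_truncSeries] at hL
  rw [tendsto_nhds_unique hL ((tendsto_oddEsymm n).const_mul _), cosCoeff]
  rcases lt_or_ge n d with h | h
  · simp [Nat.choose_eq_zero_of_lt h]
  · obtain ⟨k, rfl⟩ := Nat.exists_eq_add_of_le h
    rw [Nat.add_sub_cancel_left, pow_add]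
    have hd : ((-1 : ℝ) ^ d) * (-1) ^ d = 1 := by rw [← mul_pow]; simp
    linear_combination (-(-1) ^ k * ((d + k).choose d : ℝ) *
      ((Real.pi ^ 2 / 4) ^ (d + k) / (Nat.factorial (2 * (d + k)) : ℝ))) * hd

theorem t1_one : t1 1 = Real.pi ^ 2 / 8 := by
  have h := sum_antidiagonal_cosCoeff_mul_Tsum 1 1
  simp [Finset.Nat.antidiagonal_succ, Tsum_zero_one, Tsum_one, cosCoeff, Nat.factorial] at h
  linarith

theorem t1_two : t1 2 = Real.pi ^ 4 / 96 := by
  have h := sum_antidiagonal_cosCoeff_mul_Tsum 2 1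
  simp [Finset.Nat.antidiagonal_succ, Tsum_zero_one, Tsum_one, cosCoeff, Nat.factorial,
    t1_one] at h
  linarith

/-- `cos (π √y / 2)` as a power series in `y`. -/
noncomputable def cosSeries : PowerSeries ℝ := PowerSeries.mk cosCoeff

/-- The generating series of the sums `Tsum n d`. -/
noncomputable def TsumSeries (d : ℕ) : PowerSeries ℝ := PowerSeries.mk fun n => Tsum n d

theorem coeff_cosSeries_mul_TsumSeries (n d : ℕ) :
    PowerSeries.coeff n (cosSeries * TsumSeries d) = (-1) ^ d * n.choose d * cosCoeff n := by
  rw [PowerSeries.coeff_mul, ← sum_antidiagonal_cosCoeff_mul_Tsum]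
  simp [cosSeries, TsumSeries]

theorem cosSeries_ne_zero : cosSeries ≠ 0 := fun h => by
  simpa [cosSeries, cosCoeff] using congrArg (PowerSeries.coeff 0) h

theorem choose_six_cast (n : ℕ) :
    (n.choose 6 : ℝ) = n * (n - 1) * (n - 2) * (n - 3) * (n - 4) * (n - 5) / 720 := by
  rw [Nat.cast_choose_eq_descPochhammer_div]
  simp [descPochhammer_succ_eval, Nat.factorial]

open PowerSeries in
theorem TsumSeries_six :
    TsumSeries 6 = C (21 / 512) * TsumSeries 1
      - C (7 / 192 * (Real.pi ^ 2 / 8)) * (X * TsumSeries 1)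
      + C (1 / 256 * (Real.pi ^ 4 / 96)) * (X * (X * TsumSeries 1))
      + (C (-21 / 1024 * (Real.pi ^ 2 / 4)) * X
        + C (7 / 3072 * (Real.pi ^ 2 / 4) ^ 2) * (X * X)
        + C (-1 / 46080 * (Real.pi ^ 2 / 4) ^ 3) * (X * (X * X))) := by
  refine mul_left_cancel₀ cosSeries_ne_zero ?_
  have hexp : ∀ (E T : PowerSeries ℝ) (a b c d e f : ℝ),
      E * (C a * T - C b * (X * T) + C c * (X * (X * T))
        + (C d * X + C e * (X * X) + C f * (X * (X * X)))) =
      C a * (E * T) - C b * (X * (E * T)) + C c * (X * (X * (E * T)))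
        + C d * (X * E) + C e * (X * (X * E)) + C f * (X * (X * (X * E))) := by
    intros; ring
  rw [hexp]
  have hE : ∀ n, coeff n cosSeries = cosCoeff n := fun n => by simp [cosSeries]
  ext n
  simp only [map_add, map_sub, coeff_C_mul, coeff_cosSeries_mul_TsumSeries, choose_six_cast,
    Nat.choose_one_right]
  rcases n with _ | _ | _ | n <;>
    simp only [coeff_succ_X_mul, coeff_zero_X_mul, coeff_cosSeries_mul_TsumSeries,
      Nat.choose_one_right, hE]
  · simp
  · have h0 := cosCoeff_succ 0
    norm_num at h0 ⊢
    linear_combination (21 / 1024) * h0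
  · have h0 := cosCoeff_succ 0
    have h1 := cosCoeff_succ 1
    norm_num at h0 h1 ⊢
    linear_combination (-7 / 384 + 21 / 1024 + 7 / 1536) * h1
      - 7 / 3072 * (Real.pi ^ 2 / 4) * h0
  · have h1 := cosCoeff_succ n
    have h2 := cosCoeff_succ (n + 1)
    have h3 := cosCoeff_succ (n + 2)
    push_cast at h1 h2 h3 ⊢
    set q := Real.pi ^ 2 / 4 with hq
    have hp2 : Real.pi ^ 2 = 4 * q := by rw [hq]; ring
    have hp4 : Real.pi ^ 4 = 16 * q ^ 2 := by rw [hq]; ring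
    rw [hp2, hp4]
    linear_combination
      (-(7 / 384 * ((n : ℝ) + 2) - 21 / 1024)
        + (7 / 3072 - 1 / 1536 * ((n : ℝ) + 1)) * ((2 * n + 3) * (2 * n + 4))
        + 1 / 46080 * ((2 * n + 1) * (2 * n + 2)) * ((2 * n + 3) * (2 * n + 4))) * h3
      - ((7 / 3072 - 1 / 1536 * ((n : ℝ) + 1))
        + 1 / 46080 * ((2 * n + 1) * (2 * n + 2))) * q * h2
      + 1 / 46080 * q ^ 2 * h1

end

/-- Sum formula for multiple t-values at even arguments of depth 6. -/
theorem T2n_depth_6 (n : ℕ) (hn : 6 ≤ n) :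
    Tsum n 6 = 21 / 512 * t1 n - 7 / 192 * t1 1 * t1 (n - 1) + 1 / 256 * t1 2 * t1 (n - 2) := by
  obtain ⟨k, rfl⟩ := Nat.exists_eq_add_of_le' hn
  have h := congrArg (PowerSeries.coeff (k + 6)) TsumSeries_six
  simp only [TsumSeries, map_add, map_sub, PowerSeries.coeff_C_mul, PowerSeries.coeff_succ_X_mul,
    PowerSeries.coeff_mk, PowerSeries.coeff_X] at h
  rw [Tsum_one (by omega), Tsum_one (by omega), Tsum_one (by omega)] at h
  rw [t1_one, t1_two]
  simpa [mul_assoc] using h
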